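/- Let X be a measurable space, D a probability measure on X × ℝ with Y ∈ {0,1} D-almost surely, g : X → ℝ measurable, and f := σ∘g the induced predictor, where σ(s) = 1/(1+e^{−s}). Then the smooth calibration error of f is bounded by the dual smooth calibration error of g: smCE(f,D) ≤ smCE^{ψ,1/4}(g,D). -/

import Mathlib

open MeasureTheory Set
open scoped NNReal

/-- Smooth calibration error of a predictor `f` w.r.t. a distribution `D` on `X × ℝ`. -/
noncomputable def smCE {X : Type*} [MeasurableSpace X] (D : Measure (X × ℝ)) (f : X → ℝ) : ℝ :=
  sSup {r : ℝ | ∃ h : ℝ → ℝ, LipschitzOnWith 1 h (Icc 0 1) ∧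
    (∀ v ∈ Icc (0:ℝ) 1, h v ∈ Icc (-1:ℝ) 1) ∧
    r = ∫ p, h (f p.1) * (p.2 - f p.1) ∂D}

/-- The sigmoid function `σ(s) = 1/(1+e^{−s})`. -/
noncomputable def sigm (s : ℝ) : ℝ := 1 / (1 + Real.exp (-s))

/-- Dual smooth calibration error of a logit function `g` w.r.t. `D`. -/
noncomputable def smCEdual {X : Type*} [MeasurableSpace X] (D : Measure (X × ℝ))
    (g : X → ℝ) : ℝ :=
  sSup {r : ℝ | ∃ h : ℝ → ℝ, LipschitzWith (1/4 : ℝ≥0) h ∧ (∀ v : ℝ, h v ∈ Icc (-1:ℝ) 1) ∧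
    r = ∫ p, h (g p.1) * (p.2 - sigm (g p.1)) ∂D}

theorem sigm_eq_sigmoid : sigm = Real.sigmoid := by
  ext s
  rw [sigm, Real.sigmoid_def, one_div]

theorem lipschitzWith_sigmoid : LipschitzWith (1 / 4 : ℝ≥0) Real.sigmoid := by
  refine lipschitzWith_of_nnnorm_deriv_le differentiable_sigmoid fun x => ?_
  rw [← NNReal.coe_le_coe, coe_nnnorm, Real.deriv_sigmoid, Real.norm_eq_abs, abs_of_nonneg
    (mul_nonneg (Real.sigmoid_nonneg x) (sub_nonneg.2 (Real.sigmoid_le_one x)))]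
  push_cast
  nlinarith [sq_nonneg (Real.sigmoid x - 1 / 2)]

theorem sigmoid_mem_Icc (s : ℝ) : Real.sigmoid s ∈ Icc (0 : ℝ) 1 :=
  ⟨Real.sigmoid_nonneg s, Real.sigmoid_le_one s⟩

/-- The dual calibration gaps of test functions with values in `[-1, 1]` are at most `1`. -/
theorem integral_mul_sub_sigmoid_le_one {X : Type*} [MeasurableSpace X] (D : Measure (X × ℝ))
    [IsProbabilityMeasure D] (hY : ∀ᵐ p ∂D, p.2 = 0 ∨ p.2 = 1) (g : X → ℝ) {h : ℝ → ℝ}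
    (hh : ∀ v, h v ∈ Icc (-1 : ℝ) 1) :
    ∫ p, h (g p.1) * (p.2 - Real.sigmoid (g p.1)) ∂D ≤ 1 := by
  have hbound : ∀ᵐ p ∂D, ‖h (g p.1) * (p.2 - Real.sigmoid (g p.1))‖ ≤ 1 := by
    filter_upwards [hY] with p hp
    obtain ⟨h0, h1⟩ := sigmoid_mem_Icc (g p.1)
    rw [norm_mul]
    refine mul_le_one₀ (abs_le.2 (hh _)) (norm_nonneg _) (abs_le.2 ?_)
    rcases hp with hp | hp <;> rw [hp] <;> constructor <;> linarith
  simpa using (le_abs_self _).trans (norm_integral_le_of_norm_le_const hbound)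

/-- the smooth calibration error of the induced predictor `f = σ ∘ g` is
bounded by the dual smooth calibration error of the logit function `g`. -/
theorem smCE_sigmoid_le_smCEdual
    {X : Type*} [MeasurableSpace X] (D : Measure (X × ℝ)) [IsProbabilityMeasure D]
    (hY : ∀ᵐ p ∂D, p.2 = 0 ∨ p.2 = 1)
    (g : X → ℝ) (hg : Measurable g)
    (f : X → ℝ) (hf : f = fun x => sigm (g x)) :
    smCE D f ≤ smCEdual D g := by
  subst hf
  refine csSup_le_csSup ⟨1, ?_⟩ ⟨0, fun _ => 0, ?_, by simp, by simp⟩ ?_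
  · rintro r ⟨h, -, hh, rfl⟩
    simpa only [sigm_eq_sigmoid] using integral_mul_sub_sigmoid_le_one D hY g hh
  · exact (LipschitzWith.const' 0).weaken zero_le_one |>.lipschitzOnWith
  · rintro r ⟨h, hLip, hh, rfl⟩
    refine ⟨fun s => h (sigm s), ?_, fun v => ?_, rfl⟩
    · rw [sigm_eq_sigmoid, ← lipschitzOnWith_univ, ← one_mul (1 / 4 : ℝ≥0)]
      exact hLip.comp lipschitzWith_sigmoid.lipschitzOnWith fun s _ => sigmoid_mem_Icc s
    · rw [sigm_eq_sigmoid]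
      exact hh _ (sigmoid_mem_Icc v)
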